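/- Let N ≥ 4 be an integer and r₀ > 0. For δ ∈ ℝ with 1 + δr² > 0 on [0,r₀], call u a solution of problem (P_δ) if u ∈ C²((0,r₀]) ∩ C¹([0,r₀]), u''(r) + ((N−2)/r) u'(r) + 8(N−2) e^{u(r)} − (2(N−3)δ/(1+δr²))(r u'(r) + 2) = 0 for all r ∈ (0,r₀], u(0) = 0, and u'(0) = 0. Then (P₀) has a unique solution u₀, and for every ε > 0 there exists δ₀ > 0 such that for every δ with |δ| < δ₀ problem (P_δ) has a solution u_δ satisfying sup_{r ∈ [0,r₀]} |u₀(r) − u_δ(r)| + sup_{r ∈ [0,r₀]} |u₀'(r) − u_δ'(r)| < ε. -/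

import Mathlib

open Real Set Filter

/-- `u` is a solution of problem (P_δ) on `[0, r₀]`:
`u ∈ C²((0,r₀]) ∩ C¹([0,r₀])`, it satisfies
`u'' + ((N-2)/r) u' + 8(N-2) e^u - (2(N-3)δ/(1+δr²))(r u' + 2) = 0` on `(0,r₀]`,
and `u(0) = 0`, `u'(0) = 0`. -/
def IsSolP (N : ℕ) (r₀ δ : ℝ) (u : ℝ → ℝ) : Prop :=
  ContDiffOn ℝ 2 u (Ioc 0 r₀) ∧ ContDiffOn ℝ 1 u (Icc 0 r₀) ∧
  (∀ r ∈ Ioc (0:ℝ) r₀,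
    derivWithin (derivWithin u (Icc 0 r₀)) (Icc 0 r₀) r
      + (((N : ℝ) - 2) / r) * derivWithin u (Icc 0 r₀) r
      + 8 * ((N : ℝ) - 2) * Real.exp (u r)
      - (2 * ((N : ℝ) - 3) * δ / (1 + δ * r ^ 2)) * (r * derivWithin u (Icc 0 r₀) r + 2) = 0) ∧
  u 0 = 0 ∧ derivWithin u (Icc 0 r₀) 0 = 0

/-- The solution operator `f ↦ t ^ (-m) ∫₀ᵗ s ^ m f(s) ds` of `(t ^ m v)' = t ^ m f`, `v(0) = 0`,
rescaled to the unit interval so that it makes sense at `t = 0`. -/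
noncomputable def radialInt (m : ℕ) (f : ℝ → ℝ) (t : ℝ) : ℝ :=
  t * ∫ τ in (0:ℝ)..1, τ ^ m * f (t * τ)

lemma continuous_radialInt {m : ℕ} {f : ℝ → ℝ} (hf : Continuous f) :
    Continuous (radialInt m f) := by
  unfold radialInt
  refine continuous_id.mul ?_
  apply intervalIntegral.continuous_parametric_intervalIntegral_of_continuous'
  fun_prop

lemma pow_mul_radialInt (m : ℕ) (f : ℝ → ℝ) (t : ℝ) :
    t ^ m * radialInt m f t = ∫ s in (0:ℝ)..t, s ^ m * f s := by
  have h := intervalIntegral.mul_integral_comp_mul_left (a := 0) (b := 1)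
    (f := fun s => s ^ m * f s) t
  simp only [mul_zero, mul_one] at h
  rw [← h, radialInt, mul_left_comm, ← intervalIntegral.integral_const_mul]
  congr 2
  ext τ
  ring

lemma radialInt_zero (m : ℕ) (f : ℝ → ℝ) : radialInt m f 0 = 0 := by simp [radialInt]

lemma radialInt_congr {m : ℕ} {f g : ℝ → ℝ} {t : ℝ} (ht : 0 ≤ t)
    (h : ∀ s ∈ Icc 0 t, f s = g s) : radialInt m f t = radialInt m g t := by
  unfold radialInt
  congr 1
  apply intervalIntegral.integral_congr
  intro τ hτ
  rw [uIcc_of_le zero_le_one] at hτ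
  simp only
  rw [h _ ⟨mul_nonneg ht hτ.1, mul_le_of_le_one_right ht hτ.2⟩]

lemma radialInt_sub {m : ℕ} {f g : ℝ → ℝ} (hf : Continuous f) (hg : Continuous g) (t : ℝ) :
    radialInt m f t - radialInt m g t = radialInt m (fun s => f s - g s) t := by
  unfold radialInt
  rw [← mul_sub, ← intervalIntegral.integral_sub]
  · congr 2; ext τ; ring
  all_goals exact Continuous.intervalIntegrable (by fun_prop) _ _

lemma hasDerivAt_radialInt {m : ℕ} {f : ℝ → ℝ} (hf : Continuous f) {t : ℝ} (ht : 0 < t) :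
    HasDerivAt (radialInt m f) (f t - m / t * radialInt m f t) t := by
  have hI : HasDerivAt (fun t => ∫ s in (0:ℝ)..t, s ^ m * f s) (t ^ m * f t) t := by
    have hc : Continuous fun s => s ^ m * f s := by fun_prop
    exact hc.integral_hasStrictDerivAt 0 t |>.hasDerivAt
  have hd := hI.div (hasDerivAt_pow m t) (pow_pos ht m).ne'
  have he : radialInt m f =ᶠ[nhds t] fun t => (∫ s in (0:ℝ)..t, s ^ m * f s) / t ^ m := by
    filter_upwards [lt_mem_nhds ht] with x hx
    rw [← pow_mul_radialInt, mul_div_cancel_left₀ _ (pow_pos hx m).ne']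
  refine (hd.congr_of_eventuallyEq he).congr_deriv ?_
  rw [← pow_mul_radialInt]
  have : t ^ m ≠ 0 := (pow_pos ht m).ne'
  rcases m with _ | m
  · simp
  · simp only [Nat.add_sub_cancel]
    field_simp
    push_cast
    ring

lemma abs_radialInt_le {m : ℕ} {f B : ℝ → ℝ} (hf : Continuous f) (hB : Continuous B) {t : ℝ}
    (ht : 0 ≤ t) (h : ∀ s ∈ Icc 0 t, |f s| ≤ B s) :
    |radialInt m f t| ≤ ∫ s in (0:ℝ)..t, B s := by
  have hs := intervalIntegral.mul_integral_comp_mul_left (a := 0) (b := 1) (f := B) t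
  simp only [mul_zero, mul_one] at hs
  rw [← hs, radialInt, abs_mul, abs_of_nonneg ht]
  refine mul_le_mul_of_nonneg_left ?_ ht
  refine (intervalIntegral.abs_integral_le_integral_abs zero_le_one).trans ?_
  refine intervalIntegral.integral_mono_on zero_le_one
    (Continuous.intervalIntegrable (by fun_prop) _ _)
    (Continuous.intervalIntegrable (by fun_prop) _ _) ?_
  intro τ hτ
  have h1 := h _ ⟨mul_nonneg ht hτ.1, mul_le_of_le_one_right ht hτ.2⟩
  rw [abs_mul, abs_of_nonneg (pow_nonneg hτ.1 m)]
  exact (mul_le_of_le_one_left (abs_nonneg _) (pow_le_one₀ hτ.1 hτ.2)).trans h1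

lemma radialInt_nonpos {m : ℕ} {f : ℝ → ℝ} {t : ℝ} (ht : 0 ≤ t) (h : ∀ s, f s ≤ 0) :
    radialInt m f t ≤ 0 := by
  refine mul_nonpos_of_nonneg_of_nonpos ht ?_
  rw [← neg_nonneg, ← intervalIntegral.integral_neg]
  refine intervalIntegral.integral_nonneg zero_le_one fun τ hτ => ?_
  rw [← mul_neg]
  exact mul_nonneg (pow_nonneg hτ.1 m) (neg_nonneg.2 (h _))

lemma integral_exp_mul_le {L D t : ℝ} (hL : 0 < L) (hD : 0 ≤ D) :
    ∫ s in (0:ℝ)..t, D * Real.exp (L * s) ≤ D / L * Real.exp (L * t) := by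
  have h := intervalIntegral.integral_comp_mul_left (a := 0) (b := t) Real.exp hL.ne'
  rw [intervalIntegral.integral_const_mul, h, mul_zero, integral_exp, Real.exp_zero, smul_eq_mul]
  have : 0 ≤ D / L := by positivity
  calc D * (L⁻¹ * (Real.exp (L * t) - 1)) = D / L * Real.exp (L * t) - D / L := by ring
    _ ≤ _ := by linarith

/-- The integral operator whose fixed points are the derivatives `v = u'` of the solutions of
`u'' + (m / r) u' = G(r, u, u')`, `u(0) = u'(0) = 0`. -/
noncomputable def radialMap (m : ℕ) (G : ℝ → ℝ → ℝ → ℝ) (v : ℝ → ℝ) : ℝ → ℝ :=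
  radialInt m fun s => G s (∫ x in (0:ℝ)..s, v x) (v s)

lemma continuous_primitive_zero {v : ℝ → ℝ} (hv : Continuous v) :
    Continuous fun s => ∫ x in (0:ℝ)..s, v x :=
  intervalIntegral.continuous_primitive (fun _ _ => hv.intervalIntegrable _ _) 0

lemma continuous_radialMap_integrand {G : ℝ → ℝ → ℝ → ℝ}
    (hG : Continuous fun p : ℝ × ℝ × ℝ => G p.1 p.2.1 p.2.2) {v : ℝ → ℝ} (hv : Continuous v) :
    Continuous fun s => G s (∫ x in (0:ℝ)..s, v x) (v s) :=
  hG.comp (continuous_id.prodMk ((continuous_primitive_zero hv).prodMk hv))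

lemma continuous_radialMap {m : ℕ} {G : ℝ → ℝ → ℝ → ℝ}
    (hG : Continuous fun p : ℝ × ℝ × ℝ => G p.1 p.2.1 p.2.2) {v : ℝ → ℝ} (hv : Continuous v) :
    Continuous (radialMap m G v) :=
  continuous_radialInt (continuous_radialMap_integrand hG hv)

section Contraction

variable {m : ℕ} {r₀ K : ℝ} {G : ℝ → ℝ → ℝ → ℝ}

lemma abs_radialMap_sub_le (hK : 0 ≤ K)
    (hG : Continuous fun p : ℝ × ℝ × ℝ => G p.1 p.2.1 p.2.2)
    (hlip : ∀ s ∈ Icc 0 r₀, ∀ a b a' b', |G s a b - G s a' b'| ≤ K * (|a - a'| + |b - b'|))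
    {v w : ℝ → ℝ} (hv : Continuous v) (hw : Continuous w) {D : ℝ} (hD : 0 ≤ D)
    (h : ∀ s ∈ Icc 0 r₀, |v s - w s| ≤ D * Real.exp ((4 * K + 1) * s))
    {t : ℝ} (ht : t ∈ Icc 0 r₀) :
    |radialMap m G v t - radialMap m G w t| ≤ D / 2 * Real.exp ((4 * K + 1) * t) := by
  set L := 4 * K + 1 with hLdef
  have hL : 0 < L := by positivity
  have hL1 : 1 ≤ L := by linarith
  have hcv := continuous_radialMap_integrand hG hv
  have hcw := continuous_radialMap_integrand hG hw
  rw [radialMap, radialMap, radialInt_sub hcv hcw]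
  have hB : Continuous fun s => 2 * K * D * Real.exp (L * s) := by fun_prop
  refine (abs_radialInt_le (hcv.sub hcw) hB ht.1 ?_).trans ?_
  · intro s hs
    have hs' : s ∈ Icc 0 r₀ := ⟨hs.1, hs.2.trans ht.2⟩
    refine (hlip s hs' _ _ _ _).trans ?_
    have h1 : |(∫ x in (0:ℝ)..s, v x) - ∫ x in (0:ℝ)..s, w x| ≤ D * Real.exp (L * s) := by
      rw [← intervalIntegral.integral_sub (hv.intervalIntegrable _ _) (hw.intervalIntegrable _ _)]
      refine (intervalIntegral.abs_integral_le_integral_abs hs.1).trans ?_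
      refine (intervalIntegral.integral_mono_on (g := fun x => D * Real.exp (L * x)) hs.1
        (Continuous.intervalIntegrable (by fun_prop) _ _)
        (Continuous.intervalIntegrable (by fun_prop) _ _)
        fun x hx => h x ⟨hx.1, hx.2.trans hs'.2⟩).trans ?_
      refine (integral_exp_mul_le hL hD).trans ?_
      gcongr
      exact div_le_self hD hL1
    calc _ ≤ K * (D * Real.exp (L * s) + D * Real.exp (L * s)) := by gcongr; exact h s hs'
      _ = _ := by ring
  · refine (integral_exp_mul_le hL (by positivity)).trans ?_
    gcongr ?_ * _
    rw [div_le_iff₀ hL, hLdef]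
    nlinarith

lemma exists_fixedPoint_radialMap (hr₀ : 0 ≤ r₀) (hK : 0 ≤ K)
    (hG : Continuous fun p : ℝ × ℝ × ℝ => G p.1 p.2.1 p.2.2)
    (hlip : ∀ s ∈ Icc 0 r₀, ∀ a b a' b', |G s a b - G s a' b'| ≤ K * (|a - a'| + |b - b'|)) :
    ∃ v : ℝ → ℝ, Continuous v ∧ ∀ t ∈ Icc 0 r₀, v t = radialMap m G v t := by
  set L := 4 * K + 1
  let unweight : C(Icc 0 r₀, ℝ) → ℝ → ℝ := fun w s => Real.exp (L * s) * w (projIcc 0 r₀ hr₀ s)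
  have hunweight : ∀ w, Continuous (unweight w) := fun w =>
    (Real.continuous_exp.comp (continuous_const.mul continuous_id)).mul
      (w.continuous.comp continuous_projIcc)
  let T : C(Icc 0 r₀, ℝ) → C(Icc 0 r₀, ℝ) := fun w =>
    ⟨fun t => Real.exp (-(L * t)) * radialMap m G (unweight w) t, by
      have := continuous_radialMap (m := m) hG (hunweight w)
      fun_prop⟩
  have hT : ContractingWith (1 / 2) T := by
    refine ⟨by rw [← NNReal.coe_lt_coe]; norm_num, LipschitzWith.of_dist_le_mul fun w w' => ?_⟩
    rw [ContinuousMap.dist_le (by positivity)]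
    intro t
    have h := abs_radialMap_sub_le (m := m) hK hG hlip (hunweight w) (hunweight w')
      (D := dist w w') dist_nonneg (fun s hs => ?_) t.2
    · rw [Real.dist_eq]
      change |Real.exp (-(L * t)) * radialMap m G (unweight w) t
        - Real.exp (-(L * t)) * radialMap m G (unweight w') t| ≤ _
      rw [← mul_sub, abs_mul, abs_of_pos (Real.exp_pos _)]
      calc _ ≤ Real.exp (-(L * t)) * (dist w w' / 2 * Real.exp (L * t)) := by gcongr
        _ = dist w w' / 2 * (Real.exp (-(L * t)) * Real.exp (L * t)) := by ring
        _ = _ := by rw [← Real.exp_add]; simp; ring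
    · change |Real.exp (L * s) * _ - Real.exp (L * s) * _| ≤ _
      rw [← mul_sub, abs_mul, abs_of_pos (Real.exp_pos _), mul_comm, ← Real.dist_eq]
      gcongr
      exact ContinuousMap.dist_apply_le_dist _
  have hfix : T hT.fixedPoint = hT.fixedPoint := hT.fixedPoint_isFixedPt
  refine ⟨unweight hT.fixedPoint, hunweight _, fun t ht => ?_⟩
  have h := DFunLike.congr_fun hfix ⟨t, ht⟩
  change Real.exp (L * t) * _ = _
  rw [projIcc_of_mem hr₀ ht, ← h]
  change Real.exp (L * t) * (Real.exp (-(L * t)) * _) = _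
  rw [← mul_assoc, ← Real.exp_add]
  simp

lemma abs_sub_le_of_approx_fixedPoint (hK : 0 ≤ K)
    (hG : Continuous fun p : ℝ × ℝ × ℝ => G p.1 p.2.1 p.2.2)
    (hlip : ∀ s ∈ Icc 0 r₀, ∀ a b a' b', |G s a b - G s a' b'| ≤ K * (|a - a'| + |b - b'|))
    {v w : ℝ → ℝ} (hv : Continuous v) (hw : Continuous w) {η : ℝ}
    (hvfix : ∀ t ∈ Icc 0 r₀, v t = radialMap m G v t)
    (hwfix : ∀ t ∈ Icc 0 r₀, |w t - radialMap m G w t| ≤ η)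
    {t : ℝ} (ht : t ∈ Icc 0 r₀) :
    |w t - v t| ≤ 2 * η * Real.exp ((4 * K + 1) * r₀) := by
  set L := 4 * K + 1 with hLdef
  have hη : 0 ≤ η := (abs_nonneg _).trans (hwfix t ht)
  obtain ⟨x, hx, hmax⟩ := (isCompact_Icc (a := (0:ℝ)) (b := r₀)).exists_isMaxOn ⟨t, ht⟩
    (f := fun s => Real.exp (-(L * s)) * |w s - v s|) (by fun_prop)
  set M := Real.exp (-(L * x)) * |w x - v x| with hM
  have hM0 : 0 ≤ M := by positivity
  have hle : ∀ s ∈ Icc 0 r₀, |w s - v s| ≤ M * Real.exp (L * s) := fun s hs => by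
    have h1 : Real.exp (-(L * s)) * |w s - v s| ≤ M := hmax hs
    calc |w s - v s| = Real.exp (-(L * s)) * |w s - v s| * Real.exp (L * s) := by
          rw [mul_right_comm, ← Real.exp_add]; simp
      _ ≤ _ := by gcongr
  have hc := abs_radialMap_sub_le (m := m) hK hG hlip hw hv hM0 hle hx
  rw [← hvfix x hx, ← hLdef] at hc
  have h2 : |w x - v x| ≤ η + M / 2 * Real.exp (L * x) :=
    (abs_sub_le _ _ _).trans (add_le_add (hwfix x hx) hc)
  have h3 : M ≤ η + M / 2 := by
    have h4 : Real.exp (-(L * x)) ≤ 1 := Real.exp_le_one_iff.2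
      (neg_nonpos.2 (mul_nonneg (by positivity) hx.1))
    have h5 : Real.exp (-(L * x)) * Real.exp (L * x) = 1 := by rw [← Real.exp_add]; simp
    calc M ≤ Real.exp (-(L * x)) * (η + M / 2 * Real.exp (L * x)) := by rw [hM]; gcongr
      _ = Real.exp (-(L * x)) * η + M / 2 * (Real.exp (-(L * x)) * Real.exp (L * x)) := by ring
      _ ≤ _ := by rw [h5]; nlinarith
  calc |w t - v t| ≤ M * Real.exp (L * t) := hle t ht
    _ ≤ 2 * η * Real.exp (L * r₀) := by
      gcongr
      · linarith
      · exact ht.2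

end Contraction

lemma isSolP_integral_radialInt {m : ℕ} {r₀ δ : ℝ} (hr₀ : 0 < r₀) {f : ℝ → ℝ}
    (hf : Continuous f)
    (h : ∀ s ∈ Icc 0 r₀, f s = -(8 * m * Real.exp (∫ x in (0:ℝ)..s, radialInt m f x))
      + 2 * (m - 1) * δ / (1 + δ * s ^ 2) * (s * radialInt m f s + 2)) :
    IsSolP (m + 2) r₀ δ fun r => ∫ x in (0:ℝ)..r, radialInt m f x := by
  have hV : Continuous (radialInt m f) := continuous_radialInt hf
  have hU : ∀ r, HasDerivAt (fun r => ∫ x in (0:ℝ)..r, radialInt m f x) (radialInt m f r) r :=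
    fun r => (hV.integral_hasStrictDerivAt 0 r).hasDerivAt
  have hdU : deriv (fun r => ∫ x in (0:ℝ)..r, radialInt m f x) = radialInt m f :=
    funext fun r => (hU r).deriv
  have hdW : ∀ r ∈ Icc 0 r₀, derivWithin (fun r => ∫ x in (0:ℝ)..r, radialInt m f x)
      (Icc 0 r₀) r = radialInt m f r := fun r hr =>
    (hU r).hasDerivWithinAt.derivWithin (uniqueDiffOn_Icc hr₀ r hr)
  refine ⟨?_, ?_, fun r hr => ?_, by simp, ?_⟩
  · refine ContDiffOn.mono ?_ (Ioc_subset_Ioi_self : Ioc 0 r₀ ⊆ Ioi 0)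
    rw [show (2 : WithTop ℕ∞) = 1 + 1 by norm_num, contDiffOn_succ_iff_deriv_of_isOpen isOpen_Ioi]
    refine ⟨fun r _ => (hU r).differentiableAt.differentiableWithinAt, by simp, ?_⟩
    rw [hdU, show (1 : WithTop ℕ∞) = 0 + 1 by norm_num,
      contDiffOn_succ_iff_deriv_of_isOpen isOpen_Ioi]
    refine ⟨fun r hr => (hasDerivAt_radialInt hf hr).differentiableAt.differentiableWithinAt,
      by simp, ?_⟩
    rw [contDiffOn_zero]
    refine ContinuousOn.congr (f := fun t => f t - m / t * radialInt m f t) ?_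
      fun r hr => (hasDerivAt_radialInt hf hr).deriv
    exact hf.continuousOn.sub
      ((continuousOn_const.div continuousOn_id fun r hr => (ne_of_gt hr)).mul hV.continuousOn)
  · refine ContDiff.contDiffOn (contDiff_one_iff_deriv.2 ⟨fun r => (hU r).differentiableAt, ?_⟩)
    rwa [hdU]
  · have hr' : r ∈ Icc 0 r₀ := ⟨hr.1.le, hr.2⟩
    rw [derivWithin_congr hdW (hdW r hr'), hdW r hr',
      (hasDerivAt_radialInt hf hr.1).hasDerivWithinAt.derivWithin (uniqueDiffOn_Icc hr₀ r hr'),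
      h r hr']
    push_cast
    ring
  · rw [hdW 0 ⟨le_rfl, hr₀.le⟩, radialInt_zero]

lemma IsSolP.derivWithin_eq_radialInt {m : ℕ} {r₀ : ℝ} {u f : ℝ → ℝ} (hm : m ≠ 0)
    (hu : IsSolP (m + 2) r₀ 0 u) (hf : Continuous f)
    (hfu : ∀ s ∈ Icc 0 r₀, f s = -(8 * m * Real.exp (u s))) {t : ℝ} (ht : t ∈ Icc 0 r₀) :
    derivWithin u (Icc 0 r₀) t = radialInt m f t := by
  obtain ⟨hC2, hC1, hode, -, hu0'⟩ := hu
  rcases ht.1.eq_or_lt with rfl | ht0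
  · rw [hu0', radialInt_zero]
  have hr₀ : 0 < r₀ := ht0.trans_le ht.2
  have hcont : ContinuousOn (derivWithin u (Icc 0 r₀)) (Icc 0 r₀) :=
    hC1.continuousOn_derivWithin (uniqueDiffOn_Icc hr₀) le_rfl
  have hdiff : ∀ r ∈ Ioo 0 r₀, HasDerivAt (derivWithin u (Icc 0 r₀))
      (f r - m / r * derivWithin u (Icc 0 r₀) r) r := by
    intro r hr
    have hmem : Icc 0 r₀ ∈ nhds r := Icc_mem_nhds hr.1 hr.2
    have hcd : ContDiffOn ℝ (1 + 1) u (Ioo 0 r₀) :=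
      (hC2.mono Ioo_subset_Ioc_self).of_le (by norm_num)
    have hd := ((contDiffOn_succ_iff_deriv_of_isOpen isOpen_Ioo).1 hcd).2.2
    have hda : DifferentiableAt ℝ (deriv u) r :=
      (hd.differentiableOn one_ne_zero).differentiableAt (Ioo_mem_nhds hr.1 hr.2)
    have heq : derivWithin u (Icc 0 r₀) =ᶠ[nhds r] deriv u := by
      filter_upwards [Ioo_mem_nhds hr.1 hr.2] with x hx
      exact derivWithin_of_mem_nhds (Icc_mem_nhds hx.1 hx.2)
    have hda' := (hda.congr_of_eventuallyEq heq).hasDerivAt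
    have ho := hode r ⟨hr.1, hr.2.le⟩
    rw [derivWithin_of_mem_nhds (f := derivWithin u (Icc 0 r₀)) hmem] at ho
    refine hda'.congr_deriv ?_
    rw [hfu r ⟨hr.1.le, hr.2.le⟩]
    push_cast at ho
    linear_combination ho
  have hftc := intervalIntegral.integral_eq_sub_of_hasDerivAt_of_le ht.1
    (f := fun r => r ^ m * derivWithin u (Icc 0 r₀) r) (f' := fun r => r ^ m * f r)
    ((continuous_pow m).continuousOn.mul (hcont.mono (Icc_subset_Icc_right ht.2)))
    (fun r hr => ?_) (Continuous.intervalIntegrable (by fun_prop) _ _)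
  · rw [← pow_mul_radialInt] at hftc
    simp only [zero_pow hm, zero_mul, sub_zero] at hftc
    exact (mul_left_cancel₀ (pow_pos ht0 m).ne' hftc).symm
  · refine ((hasDerivAt_pow m r).mul (hdiff r ⟨hr.1, hr.2.trans_le ht.2⟩)).congr_deriv ?_
    have := hr.1.ne'
    obtain ⟨k, rfl⟩ := Nat.exists_eq_succ_of_ne_zero hm
    simp only [Nat.succ_eq_add_one, Nat.add_sub_cancel]
    field_simp
    ring

/-- The right-hand side of `u'' + (m / r) u' = G(r, u, u')`, where the exponential is truncated
above the value `1` and the singular coefficient is frozen outside `[0, r₀]`. -/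
noncomputable def truncRhs (m : ℕ) (r₀ δ s a b : ℝ) : ℝ :=
  -(8 * m * Real.exp (min a 1))
    + 2 * (m - 1) * δ / (1 + δ * (max 0 (min s r₀)) ^ 2) * (s * b + 2)

lemma truncRhs_of_mem {m : ℕ} {r₀ δ s a b : ℝ} (hs : s ∈ Icc 0 r₀) (ha : a ≤ 1) :
    truncRhs m r₀ δ s a b
      = -(8 * m * Real.exp a) + 2 * (m - 1) * δ / (1 + δ * s ^ 2) * (s * b + 2) := by
  rw [truncRhs, min_eq_left ha, min_eq_left hs.2, max_eq_right hs.1]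

section TruncRhs

variable {m : ℕ} {r₀ δ : ℝ}

lemma half_le_one_add_mul_sq (hδ : |δ| * r₀ ^ 2 ≤ 1 / 2) {s : ℝ}
    (hs : s ∈ Icc 0 r₀) : 1 / 2 ≤ 1 + δ * s ^ 2 := by
  have h1 : |δ * s ^ 2| ≤ 1 / 2 := by
    rw [abs_mul, abs_of_nonneg (sq_nonneg s)]
    refine le_trans ?_ hδ
    gcongr
    exacts [hs.1, hs.2]
  linarith [neg_abs_le (δ * s ^ 2)]

lemma half_le_truncDenom (hr₀ : 0 < r₀) (hδ : |δ| * r₀ ^ 2 ≤ 1 / 2) (s : ℝ) :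
    1 / 2 ≤ 1 + δ * (max 0 (min s r₀)) ^ 2 :=
  half_le_one_add_mul_sq hδ ⟨le_max_left _ _, max_le hr₀.le (min_le_right _ _)⟩

lemma continuous_truncRhs (hr₀ : 0 < r₀) (hδ : |δ| * r₀ ^ 2 ≤ 1 / 2) :
    Continuous fun p : ℝ × ℝ × ℝ => truncRhs m r₀ δ p.1 p.2.1 p.2.2 := by
  have h : ∀ p : ℝ × ℝ × ℝ, 1 + δ * (max 0 (min p.1 r₀)) ^ 2 ≠ 0 := fun p => by
    linarith [half_le_truncDenom hr₀ hδ p.1]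
  unfold truncRhs
  fun_prop (disch := exact h)

lemma abs_truncCoeff_le (hm : 1 ≤ m) (hr₀ : 0 < r₀) (hδ : |δ| * r₀ ^ 2 ≤ 1 / 2) (s : ℝ) :
    |2 * (m - 1) * δ / (1 + δ * (max 0 (min s r₀)) ^ 2)| ≤ 4 * m * |δ| := by
  have h := half_le_truncDenom hr₀ hδ s
  have hm' : (1:ℝ) ≤ m := by exact_mod_cast hm
  rw [abs_div, abs_mul, abs_of_nonneg (by linarith : (0:ℝ) ≤ 2 * (m - 1)),
    abs_of_pos (a := 1 + _) (by linarith), div_le_iff₀ (by linarith)]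
  have h0 : 0 ≤ m * |δ| := by positivity
  nlinarith [abs_nonneg δ]

lemma abs_exp_min_one_sub_le (a b : ℝ) :
    |Real.exp (min a 1) - Real.exp (min b 1)| ≤ Real.exp 1 * |a - b| := by
  have h := (convex_Iic (1:ℝ)).norm_image_sub_le_of_norm_deriv_le (f := Real.exp)
    (C := Real.exp 1) (fun x _ => Real.differentiableAt_exp)
    (fun x hx => by simpa [abs_of_pos (Real.exp_pos _)] using hx)
    (mem_Iic.2 (min_le_right b 1)) (mem_Iic.2 (min_le_right a 1))
  refine h.trans ?_
  gcongr
  simpa using abs_min_sub_min_le_max a 1 b 1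

lemma abs_truncRhs_sub_le (hm : 1 ≤ m) (hr₀ : 0 < r₀) (hδ : |δ| * r₀ ^ 2 ≤ 1 / 2)
    (hδ1 : |δ| ≤ 1) {s : ℝ} (hs : s ∈ Icc 0 r₀) (a b a' b' : ℝ) :
    |truncRhs m r₀ δ s a b - truncRhs m r₀ δ s a' b'|
      ≤ (8 * m * Real.exp 1 + 4 * m * r₀) * (|a - a'| + |b - b'|) := by
  unfold truncRhs
  set c := 2 * (m - 1) * δ / (1 + δ * (max 0 (min s r₀)) ^ 2)
  have hc : |c| ≤ 4 * m * 1 := (abs_truncCoeff_le hm hr₀ hδ s).trans (by gcongr)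
  calc _ = |c * s * (b - b') - 8 * m * (Real.exp (min a 1) - Real.exp (min a' 1))| := by
        congr 1; ring
    _ ≤ |c * s * (b - b')| + |8 * m * (Real.exp (min a 1) - Real.exp (min a' 1))| := abs_sub _ _
    _ = |c| * s * |b - b'| + 8 * m * |Real.exp (min a 1) - Real.exp (min a' 1)| := by
        simp only [abs_mul, abs_of_nonneg hs.1, Nat.abs_cast, Nat.abs_ofNat]
    _ ≤ 4 * m * 1 * r₀ * |b - b'| + 8 * m * (Real.exp 1 * |a - a'|) := by
        gcongr
        · exact hs.1
        · exact hs.2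
        · exact abs_exp_min_one_sub_le a a'
    _ ≤ _ := by
        have h1 : 0 ≤ 8 * m * Real.exp 1 * |b - b'| := by positivity
        have h2 : 0 ≤ 4 * m * r₀ * |a - a'| := by positivity
        linarith

lemma isSolP_integral_radialMap (hr₀ : 0 < r₀) (hδ : |δ| * r₀ ^ 2 ≤ 1 / 2) {v : ℝ → ℝ}
    (hv : Continuous v) (hfix : ∀ t ∈ Icc 0 r₀, v t = radialMap m (truncRhs m r₀ δ) v t)
    (hle : ∀ t ∈ Icc 0 r₀, ∫ x in (0:ℝ)..t, v x ≤ 1) :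
    IsSolP (m + 2) r₀ δ fun r => ∫ x in (0:ℝ)..r, radialMap m (truncRhs m r₀ δ) v x := by
  refine isSolP_integral_radialInt hr₀
    (continuous_radialMap_integrand (continuous_truncRhs hr₀ hδ) hv) fun s hs => ?_
  have hint : ∫ x in (0:ℝ)..s, v x = ∫ x in (0:ℝ)..s, radialMap m (truncRhs m r₀ δ) v x := by
    refine intervalIntegral.integral_congr fun x hx => ?_
    rw [uIcc_of_le hs.1] at hx
    exact hfix x ⟨hx.1, hx.2.trans hs.2⟩
  change _ = -(8 * m * Real.exp (∫ x in (0:ℝ)..s, radialMap m (truncRhs m r₀ δ) v x))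
    + _ * (s * radialMap m (truncRhs m r₀ δ) v s + 2)
  rw [truncRhs_of_mem hs (hle s hs), ← hint, ← hfix s hs]

lemma radialMap_truncRhs_zero_nonpos {v : ℝ → ℝ} {t : ℝ} (ht : 0 ≤ t) :
    radialMap m (truncRhs m r₀ 0) v t ≤ 0 := by
  refine radialInt_nonpos ht fun s => ?_
  simp only [truncRhs, mul_zero, zero_div, zero_mul, add_zero]
  exact neg_nonpos.2 (by positivity)

lemma abs_radialMap_truncRhs_sub_le (hm : 1 ≤ m) (hr₀ : 0 < r₀) (hδ : |δ| * r₀ ^ 2 ≤ 1 / 2)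
    {v : ℝ → ℝ} (hv : Continuous v) {B : ℝ} (hB : ∀ s ∈ Icc 0 r₀, |s * v s + 2| ≤ B)
    {t : ℝ} (ht : t ∈ Icc 0 r₀) :
    |radialMap m (truncRhs m r₀ 0) v t - radialMap m (truncRhs m r₀ δ) v t|
      ≤ 4 * m * |δ| * B * r₀ := by
  have h0 : |(0:ℝ)| * r₀ ^ 2 ≤ 1 / 2 := by simp
  have hB0 : 0 ≤ B := (abs_nonneg _).trans (hB t ht)
  have hc0 := continuous_radialMap_integrand (continuous_truncRhs (m := m) hr₀ h0) hv
  have hc := continuous_radialMap_integrand (continuous_truncRhs (m := m) hr₀ hδ) hv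
  rw [radialMap, radialMap, radialInt_sub hc0 hc]
  refine (abs_radialInt_le (B := fun _ => 4 * m * |δ| * B) (hc0.sub hc) continuous_const ht.1
    fun s hs => ?_).trans ?_
  · have hs' : s ∈ Icc 0 r₀ := ⟨hs.1, hs.2.trans ht.2⟩
    simp only [Pi.sub_apply, truncRhs, mul_zero, zero_div, zero_mul, add_zero,
      sub_add_cancel_left]
    rw [abs_neg, abs_mul]
    gcongr
    exacts [abs_truncCoeff_le hm hr₀ hδ s, hB s hs']
  · rw [intervalIntegral.integral_const, smul_eq_mul, sub_zero, mul_comm]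
    gcongr
    exact ht.2

end TruncRhs

lemma IsSolP.exists_fixedPoint {m : ℕ} (hm : m ≠ 0) {r₀ : ℝ} (hr₀ : 0 < r₀) {u : ℝ → ℝ}
    (hu : IsSolP (m + 2) r₀ 0 u) :
    ∃ v : ℝ → ℝ, Continuous v ∧ (∀ t ∈ Icc 0 r₀, v t = radialMap m (truncRhs m r₀ 0) v t) ∧
      ∀ t ∈ Icc 0 r₀, u t = ∫ x in (0:ℝ)..t, v x := by
  have hcont : ContinuousOn (derivWithin u (Icc 0 r₀)) (Icc 0 r₀) :=
    hu.2.1.continuousOn_derivWithin (uniqueDiffOn_Icc hr₀) le_rfl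
  set v := IccExtend hr₀.le ((Icc 0 r₀).domRestrict (derivWithin u (Icc 0 r₀)))
  have hv : Continuous v := (continuousOn_iff_continuous_domRestrict.1 hcont).Icc_extend'
  have hvu : ∀ t ∈ Icc 0 r₀, v t = derivWithin u (Icc 0 r₀) t := fun t ht =>
    IccExtend_of_mem hr₀.le _ ht
  have hint : ∀ t ∈ Icc 0 r₀, u t = ∫ x in (0:ℝ)..t, v x := by
    intro t ht
    rw [intervalIntegral.integral_eq_sub_of_hasDerivAt_of_le ht.1 (f := u)
      (hu.2.1.continuousOn.mono (Icc_subset_Icc_right ht.2)) (fun x hx => ?_)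
      (hv.intervalIntegrable _ _), hu.2.2.2.1, sub_zero]
    have hx' : x ∈ Ioo 0 r₀ := ⟨hx.1, hx.2.trans_le ht.2⟩
    have hxI : x ∈ Icc 0 r₀ := Ioo_subset_Icc_self hx'
    rw [hvu x hxI]
    exact ((hu.2.1.differentiableOn one_ne_zero) x hxI).hasDerivWithinAt.hasDerivAt
      (Icc_mem_nhds hx'.1 hx'.2)
  have hf : Continuous fun s => -(8 * m * Real.exp (∫ x in (0:ℝ)..s, v x)) := by
    have := continuous_primitive_zero hv
    fun_prop
  have hvint : ∀ t ∈ Icc 0 r₀, v t = radialInt m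
      (fun s => -(8 * m * Real.exp (∫ x in (0:ℝ)..s, v x))) t := fun t ht => by
    rw [hvu t ht]
    exact hu.derivWithin_eq_radialInt hm hf (fun s hs => by rw [hint s hs]) ht
  have hvle : ∀ t ∈ Icc 0 r₀, v t ≤ 0 := fun t ht => by
    rw [hvint t ht]
    exact radialInt_nonpos ht.1 fun s => neg_nonpos.2 (by positivity)
  refine ⟨v, hv, fun t ht => ?_, hint⟩
  rw [hvint t ht]
  refine radialInt_congr ht.1 fun s hs => ?_
  have hs' : s ∈ Icc 0 r₀ := ⟨hs.1, hs.2.trans ht.2⟩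
  have hle : ∫ x in (0:ℝ)..s, v x ≤ 0 := by
    rw [← neg_nonneg, ← intervalIntegral.integral_neg]
    exact intervalIntegral.integral_nonneg hs.1 fun x hx =>
      neg_nonneg.2 (hvle x ⟨hx.1, hx.2.trans hs'.2⟩)
  rw [truncRhs_of_mem hs' (hle.trans zero_le_one)]
  simp

lemma abs_integral_sub_le {v w : ℝ → ℝ} (hv : Continuous v) (hw : Continuous w) {r₀ C t : ℝ}
    (ht : t ∈ Icc 0 r₀) (h : ∀ s ∈ Icc 0 r₀, |v s - w s| ≤ C) :
    |(∫ x in (0:ℝ)..t, v x) - ∫ x in (0:ℝ)..t, w x| ≤ C * r₀ := by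
  rw [← intervalIntegral.integral_sub (hv.intervalIntegrable _ _) (hw.intervalIntegrable _ _)]
  have hC : 0 ≤ C := (abs_nonneg _).trans (h t ht)
  rw [← Real.norm_eq_abs]
  refine (intervalIntegral.norm_integral_le_of_norm_le_const (C := C) fun x hx => ?_).trans ?_
  · rw [uIoc_of_le ht.1] at hx
    exact h x ⟨hx.1.le, hx.2.trans ht.2⟩
  · rw [sub_zero, abs_of_nonneg ht.1]
    gcongr
    exact ht.2

theorem stmt_13 (N : ℕ) (hN : 4 ≤ N) (r₀ : ℝ) (hr₀ : 0 < r₀) :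
    ∃ u₀ : ℝ → ℝ, IsSolP N r₀ 0 u₀ ∧
      (∀ u : ℝ → ℝ, IsSolP N r₀ 0 u → Set.EqOn u u₀ (Icc 0 r₀)) ∧
      ∀ ε : ℝ, 0 < ε → ∃ δ₀ : ℝ, 0 < δ₀ ∧ ∀ δ : ℝ, |δ| < δ₀ →
        (∀ r ∈ Icc (0:ℝ) r₀, 0 < 1 + δ * r ^ 2) ∧
        ∃ uδ : ℝ → ℝ, IsSolP N r₀ δ uδ ∧
          ∀ r ∈ Icc (0:ℝ) r₀, ∀ r' ∈ Icc (0:ℝ) r₀,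
            |u₀ r - uδ r|
              + |derivWithin u₀ (Icc 0 r₀) r' - derivWithin uδ (Icc 0 r₀) r'| < ε := by
  obtain ⟨m, rfl⟩ : ∃ m, N = m + 2 := ⟨N - 2, by omega⟩
  have hm : 1 ≤ m := by omega
  have hδ0 : |(0:ℝ)| * r₀ ^ 2 ≤ 1 / 2 := by simp
  set K : ℝ := 8 * m * Real.exp 1 + 4 * m * r₀
  have hK : 0 ≤ K := by positivity
  have hcont := continuous_truncRhs (m := m) hr₀ hδ0
  have hlip := fun s hs => abs_truncRhs_sub_le (m := m) (s := s) hm hr₀ hδ0 (by simp) hs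
  obtain ⟨v, hv, hvfix⟩ := exists_fixedPoint_radialMap (m := m) hr₀.le hK hcont hlip
  set V := radialMap m (truncRhs m r₀ 0) v
  have hV : Continuous V := continuous_radialMap hcont hv
  have hint : ∀ {δ : ℝ} {w : ℝ → ℝ},
      (∀ t ∈ Icc 0 r₀, w t = radialMap m (truncRhs m r₀ δ) w t) → ∀ t ∈ Icc 0 r₀,
      ∫ x in (0:ℝ)..t, w x = ∫ x in (0:ℝ)..t, radialMap m (truncRhs m r₀ δ) w x := by
    intro δ w hw t ht
    refine intervalIntegral.integral_congr fun x hx => ?_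
    rw [uIcc_of_le ht.1] at hx
    exact hw x ⟨hx.1, hx.2.trans ht.2⟩
  have hVint : ∀ t ∈ Icc 0 r₀, ∫ x in (0:ℝ)..t, v x ≤ 0 := by
    intro t ht
    rw [hint hvfix t ht, ← neg_nonneg, ← intervalIntegral.integral_neg]
    exact intervalIntegral.integral_nonneg ht.1 fun x hx =>
      neg_nonneg.2 (radialMap_truncRhs_zero_nonpos hx.1)
  have hderiv : ∀ {W : ℝ → ℝ}, Continuous W → ∀ t ∈ Icc 0 r₀,
      derivWithin (fun r => ∫ x in (0:ℝ)..r, W x) (Icc 0 r₀) t = W t := fun hW t ht =>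
    (hW.integral_hasStrictDerivAt 0 t).hasDerivAt.hasDerivWithinAt.derivWithin
      (uniqueDiffOn_Icc hr₀ t ht)
  refine ⟨fun r => ∫ x in (0:ℝ)..r, V x,
    isSolP_integral_radialMap hr₀ hδ0 hv hvfix fun t ht => (hVint t ht).trans zero_le_one,
    fun u hu t ht => ?_, fun ε hε => ?_⟩
  · obtain ⟨w, hw, hwfix, hwu⟩ := hu.exists_fixedPoint (by omega) hr₀
    have hwv : ∀ s ∈ Icc 0 r₀, |w s - v s| ≤ 0 := fun s hs => by
      simpa using abs_sub_le_of_approx_fixedPoint (η := 0) hK hcont hlip hv hw hvfix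
        (fun t ht => by rw [← hwfix t ht]; simp) hs
    have h := abs_integral_sub_le hw hv ht hwv
    rw [zero_mul, abs_nonpos_iff, sub_eq_zero] at h
    rw [hwu t ht, h, hint hvfix t ht]
  · obtain ⟨B, hB⟩ := (isCompact_Icc (a := (0:ℝ)) (b := r₀)).exists_bound_of_continuousOn
      (f := fun s => s * v s + 2) (by fun_prop)
    have hB0 : 0 ≤ B := (norm_nonneg _).trans (hB 0 ⟨le_rfl, hr₀.le⟩)
    set C := 2 * (4 * m * B * r₀) * Real.exp ((4 * K + 1) * r₀) with hCdef
    have hC : 0 ≤ C := by positivity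
    set D := C * (1 + r₀) + 1 with hDdef
    have hD : 0 < D := by positivity
    refine ⟨min (min 1 (1 / (2 * r₀ ^ 2))) (min (1 / D) (ε / D)), by positivity,
      fun δ hδ => ?_⟩
    simp only [lt_min_iff] at hδ
    obtain ⟨⟨hδ1, hδ2⟩, hδ3, hδ4⟩ := hδ
    have hδr : |δ| * r₀ ^ 2 ≤ 1 / 2 := by
      rw [lt_div_iff₀ (by positivity)] at hδ2
      linarith
    rw [lt_div_iff₀ hD] at hδ3 hδ4
    have hclose : C * |δ| * (1 + r₀) ≤ |δ| * D := by
      rw [hDdef]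
      linarith [abs_nonneg δ]
    refine ⟨fun r hr => by linarith [half_le_one_add_mul_sq hδr hr], ?_⟩
    have hcontδ := continuous_truncRhs (m := m) hr₀ hδr
    have hlipδ := fun s hs => abs_truncRhs_sub_le (m := m) (s := s) hm hr₀ hδr hδ1.le hs
    obtain ⟨w, hw, hwfix⟩ := exists_fixedPoint_radialMap (m := m) hr₀.le hK hcontδ hlipδ
    have hvw : ∀ s ∈ Icc 0 r₀, |v s - w s| ≤ C * |δ| := fun s hs => by
      refine (abs_sub_le_of_approx_fixedPoint hK hcontδ hlipδ hw hv hwfix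
        (η := 4 * m * |δ| * B * r₀) (fun t ht => ?_) hs).trans_eq (by rw [hCdef]; ring)
      rw [hvfix t ht]
      exact abs_radialMap_truncRhs_sub_le hm hr₀ hδr hv hB ht
    have hint_vw : ∀ t ∈ Icc 0 r₀,
        |(∫ x in (0:ℝ)..t, v x) - ∫ x in (0:ℝ)..t, w x| ≤ C * |δ| * r₀ := fun t ht =>
      abs_integral_sub_le hv hw ht hvw
    have hCδ : 0 ≤ C * |δ| := by positivity
    refine ⟨_, isSolP_integral_radialMap hr₀ hδr hw hwfix fun t ht => ?_, fun r hr r' hr' => ?_⟩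
    · linarith [hVint t ht, hint_vw t ht,
        neg_abs_le ((∫ x in (0:ℝ)..t, v x) - ∫ x in (0:ℝ)..t, w x)]
    · rw [hderiv hV r' hr', hderiv (continuous_radialMap hcontδ hw) r' hr',
        ← hvfix r' hr', ← hwfix r' hr', ← hint hwfix r hr]
      beta_reduce
      rw [← hint hvfix r hr]
      linarith [hvw r' hr', hint_vw r hr]
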